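/- arXiv:2202.02853 — 2 statements merged into one kernel-verified Lean document; each statement's English description precedes it below -/
import Mathlib

section
/- Let a ∈ ℝ with 0 < |a| < 1, σ > 0, n ≥ 2 and 1 ≤ τ ≤ n−1. Let Σ = (σ²/(1−a²))·Â_n and Σ̃ = (σ²/(1−a²))·diag(Â_τ, Â_{n−τ}), where Â_m is the m×m matrix with entries a^{|i−j|}. Then Σ and Σ̃ are positive definite, and the Kullback–Leibler divergence of the centered multivariate Gaussian N(0, Σ) from N(0, Σ̃) equals (1/2)·log( 1/(1 − a²) ). In particular this value does not depend on τ or on n. -/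
open Matrix MeasureTheory

/-- The multivariate Gaussian measure `N(μ, S)` on `Fin n → ℝ`, defined through its density
with respect to Lebesgue measure. -/
noncomputable def mvGaussian {n : ℕ} (μ : Fin n → ℝ) (S : Matrix (Fin n) (Fin n) ℝ) :
    Measure (Fin n → ℝ) :=
  volume.withDensity fun x =>
    ENNReal.ofReal ((1 / Real.sqrt ((2 * Real.pi) ^ n * S.det)) *
      Real.exp (-(1 / 2) * ((x - μ) ⬝ᵥ (S⁻¹ *ᵥ (x - μ)))))

open ProbabilityTheory

theorem pi_withDensity_ofReal {ι : Type*} [Fintype ι] {g : ℝ → ℝ} (hg0 : ∀ x, 0 ≤ g x)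
    (hg : Integrable g) :
    Measure.pi (fun _ : ι => volume.withDensity fun x => ENNReal.ofReal (g x)) =
      volume.withDensity fun z : ι → ℝ => ENNReal.ofReal (∏ i, g (z i)) := by
  have := isFiniteMeasure_withDensity_ofReal hg.2
  refine Measure.pi_eq fun s hs => ?_
  rw [withDensity_apply _ (MeasurableSet.univ_pi hs), volume_pi, Measure.restrict_pi_pi,
    ← ofReal_integral_eq_lintegral_ofReal
      (Integrable.fintype_prod (f := fun _ => g) fun i => hg.restrict)
      (Filter.Eventually.of_forall fun z => Finset.prod_nonneg fun i _ => hg0 _),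
    integral_fintype_prod_eq_prod (fun _ => g),
    ENNReal.ofReal_prod_of_nonneg fun i _ => integral_nonneg hg0]
  refine Finset.prod_congr rfl fun i _ => ?_
  rw [withDensity_apply _ (hs i), ← ofReal_integral_eq_lintegral_ofReal hg.restrict
    (Filter.Eventually.of_forall hg0)]

theorem pi_gaussianReal_eq_withDensity (n : ℕ) :
    Measure.pi (fun _ : Fin n => gaussianReal 0 1) =
      volume.withDensity fun z : Fin n → ℝ =>
        ENNReal.ofReal (1 / √((2 * Real.pi) ^ n) * Real.exp (-(1 / 2) * (z ⬝ᵥ z))) := by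
  rw [gaussianReal_of_var_ne_zero 0 one_ne_zero]
  simp only [gaussianPDF_def]
  rw [pi_withDensity_ofReal (gaussianPDFReal_nonneg 0 1) (integrable_gaussianPDFReal 0 1)]
  congr! 3 with z
  simp only [gaussianPDFReal, NNReal.coe_one, mul_one, sub_zero, Finset.prod_mul_distrib,
    ← Real.exp_sum, Finset.prod_const, Finset.card_univ, Fintype.card_fin, dotProduct,
    Finset.mul_sum]
  have hsqrt : √((2 * Real.pi) ^ n) = √(2 * Real.pi) ^ n := by
    rw [Real.sqrt_eq_iff_mul_self_eq (by positivity) (by positivity), ← mul_pow,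
      Real.mul_self_sqrt (by positivity)]
  rw [inv_pow, one_div, hsqrt]
  congr! 3 with i
  ring

theorem map_mulVec_pi_gaussianReal {n : ℕ} {B : Matrix (Fin n) (Fin n) ℝ} (hB : B.det ≠ 0) :
    (Measure.pi fun _ : Fin n => gaussianReal 0 1).map (B *ᵥ ·) = mvGaussian 0 (B * Bᵀ) := by
  have hBm : Measurable (B *ᵥ ·) := by fun_prop
  have hq (z : Fin n → ℝ) : (B *ᵥ z) ⬝ᵥ ((B * Bᵀ)⁻¹ *ᵥ (B *ᵥ z)) = z ⬝ᵥ z := by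
    have hu : IsUnit B.det := hB.isUnit
    have hut : IsUnit (Bᵀ).det := by rwa [det_transpose]
    rw [mulVec_mulVec, Matrix.mul_inv_rev, Matrix.mul_assoc, nonsing_inv_mul _ hu, Matrix.mul_one,
      dotProduct_mulVec, ← mulVec_transpose, mulVec_mulVec, ← transpose_nonsing_inv,
      transpose_transpose, nonsing_inv_mul _ hu, one_mulVec]
  have hvol := Real.map_matrix_volume_pi_eq_smul_volume_pi hB
  have hfun : ⇑(toLin' B) = (B *ᵥ ·) := by ext; simp
  rw [hfun] at hvol
  ext s hs
  rw [Measure.map_apply hBm hs, pi_gaussianReal_eq_withDensity,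
    withDensity_apply _ (hBm hs), mvGaussian, withDensity_apply _ hs]
  have key := setLIntegral_map (μ := volume) (g := (B *ᵥ ·)) (f := fun x =>
    ENNReal.ofReal (1 / √((2 * Real.pi) ^ n) *
      Real.exp (-(1 / 2) * (x ⬝ᵥ ((B * Bᵀ)⁻¹ *ᵥ x))))) hs (by fun_prop) hBm
  simp only [hq] at key
  rw [← key, hvol, Measure.restrict_smul, lintegral_smul_measure, smul_eq_mul,
    ← lintegral_const_mul _ (by fun_prop)]
  congr! 2 with x
  rw [← ENNReal.ofReal_mul (abs_nonneg _), det_mul, det_transpose, ← pow_two,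
    Real.sqrt_mul (by positivity), Real.sqrt_sq_eq_abs, sub_zero, abs_inv]
  congr 1
  field_simp

theorem exists_mul_transpose_of_posDef {n : ℕ} {S : Matrix (Fin n) (Fin n) ℝ} (hS : S.PosDef) :
    ∃ B : Matrix (Fin n) (Fin n) ℝ, B.det ≠ 0 ∧ S = B * Bᵀ := by
  have hex : ∃ B : Matrix (Fin n) (Fin n) ℝ, S = B * Bᵀ := by
    open scoped MatrixOrder in
    obtain ⟨C, hC⟩ := CStarAlgebra.nonneg_iff_eq_star_mul_self.mp hS.posSemidef.nonneg
    refine ⟨Cᵀ, ?_⟩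
    rw [hC, transpose_transpose, star_eq_conjTranspose, conjTranspose_eq_transpose_of_trivial]
  obtain ⟨B, rfl⟩ := hex
  refine ⟨B, fun h => ?_, rfl⟩
  simpa [h] using hS.det_pos.ne'

theorem integrable_eval_mul_eval_gaussian {n : ℕ} (i j : Fin n) :
    Integrable (fun z : Fin n → ℝ => z i * z j) (Measure.pi fun _ => gaussianReal 0 1) := by
  have h (i : Fin n) : MemLp (fun z : Fin n → ℝ => z i) 2 (Measure.pi fun _ => gaussianReal 0 1) :=
    (memLp_id_gaussianReal 2).comp_measurePreserving
      (measurePreserving_eval (fun _ : Fin n => gaussianReal 0 1) i)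
  exact (h i).integrable_mul (h j)

theorem integral_eval_mul_eval_gaussian {n : ℕ} (i j : Fin n) :
    ∫ z : Fin n → ℝ, z i * z j ∂(Measure.pi fun _ => gaussianReal 0 1) =
      (1 : Matrix (Fin n) (Fin n) ℝ) i j := by
  have h0 (i : Fin n) : ∫ z : Fin n → ℝ, z i ∂(Measure.pi fun _ => gaussianReal 0 1) = 0 := by
    simpa using integral_comp_eval (μ := fun _ : Fin n => gaussianReal 0 1) (i := i)
      (f := fun x : ℝ => x) (by fun_prop)
  obtain rfl | hij := eq_or_ne i j
  · have := variance_eq_integral (μ := gaussianReal 0 1) (X := fun x => x) (by fun_prop)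
    have h2 := integral_comp_eval (μ := fun _ : Fin n => gaussianReal 0 1) (i := i)
      (f := fun x : ℝ => x * x) (by fun_prop)
    rw [h2]
    simpa [pow_two] using this.symm
  · have hind := (iIndepFun_pi (μ := fun _ : Fin n => gaussianReal 0 1) (X := fun _ x => x)
      fun _ => by fun_prop).indepFun hij
    rw [hind.integral_fun_mul_eq_mul_integral, h0, one_apply_ne hij,
      zero_mul] <;>
    exact (measurable_pi_apply _).aestronglyMeasurable

theorem dotProduct_mulVec_eq_sum {n : ℕ} (M : Matrix (Fin n) (Fin n) ℝ) (x : Fin n → ℝ) :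
    x ⬝ᵥ M *ᵥ x = ∑ i, ∑ j, M i j * (x i * x j) := by
  simp only [dotProduct, mulVec, Finset.mul_sum]
  exact Finset.sum_congr rfl fun i _ => Finset.sum_congr rfl fun j _ => by ring

theorem integrable_quadratic_mvGaussian {n : ℕ} {S : Matrix (Fin n) (Fin n) ℝ} (hS : S.PosDef)
    (M : Matrix (Fin n) (Fin n) ℝ) :
    Integrable (fun x => x ⬝ᵥ M *ᵥ x) (mvGaussian 0 S) := by
  obtain ⟨B, hB, rfl⟩ := exists_mul_transpose_of_posDef hS
  rw [← map_mulVec_pi_gaussianReal hB, integrable_map_measure (by fun_prop) (by fun_prop)]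
  have : (fun x => x ⬝ᵥ M *ᵥ x) ∘ (B *ᵥ ·) = fun z => z ⬝ᵥ (Bᵀ * M * B) *ᵥ z := by
    ext z
    simp [← mulVec_mulVec, dotProduct_mulVec z, vecMul_transpose]
  rw [this]
  simp only [dotProduct_mulVec_eq_sum]
  exact integrable_finsetSum _ fun i _ => integrable_finsetSum _ fun j _ =>
    (integrable_eval_mul_eval_gaussian i j).const_mul _

theorem integral_quadratic_mvGaussian {n : ℕ} {S : Matrix (Fin n) (Fin n) ℝ} (hS : S.PosDef)
    (M : Matrix (Fin n) (Fin n) ℝ) :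
    ∫ x, x ⬝ᵥ M *ᵥ x ∂(mvGaussian 0 S) = (M * S).trace := by
  obtain ⟨B, hB, rfl⟩ := exists_mul_transpose_of_posDef hS
  rw [← map_mulVec_pi_gaussianReal hB, integral_map (by fun_prop) (by fun_prop)]
  have (z : Fin n → ℝ) : (B *ᵥ z) ⬝ᵥ M *ᵥ (B *ᵥ z) = z ⬝ᵥ (Bᵀ * M * B) *ᵥ z := by
    simp [← mulVec_mulVec, dotProduct_mulVec z, vecMul_transpose]
  simp only [this, dotProduct_mulVec_eq_sum]
  rw [integral_finsetSum _ fun i _ => integrable_finsetSum _ fun j _ =>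
    (integrable_eval_mul_eval_gaussian i j).const_mul ((Bᵀ * M * B) i j)]
  have hi (i : Fin n) := integral_finsetSum (μ := Measure.pi fun _ => gaussianReal 0 1)
    Finset.univ fun j (_ : j ∈ Finset.univ) =>
      (integrable_eval_mul_eval_gaussian i j).const_mul ((Bᵀ * M * B) i j)
  simp only [hi, integral_const_mul, integral_eval_mul_eval_gaussian, one_apply, mul_ite, mul_one,
    mul_zero, Finset.sum_ite_eq, Finset.mem_univ, if_true]
  change (Bᵀ * M * B).trace = _
  rw [Matrix.mul_assoc, trace_mul_comm, Matrix.mul_assoc]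

theorem isProbabilityMeasure_mvGaussian {n : ℕ} {S : Matrix (Fin n) (Fin n) ℝ} (hS : S.PosDef) :
    IsProbabilityMeasure (mvGaussian 0 S) := by
  obtain ⟨B, hB, rfl⟩ := exists_mul_transpose_of_posDef hS
  rw [← map_mulVec_pi_gaussianReal hB]
  exact Measure.isProbabilityMeasure_map (by fun_prop)

theorem llr_mvGaussian {n : ℕ} {S T : Matrix (Fin n) (Fin n) ℝ} (hS : S.PosDef) (hT : T.PosDef) :
    llr (mvGaussian 0 S) (mvGaussian 0 T) =ᵐ[mvGaussian 0 S] fun x =>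
      1 / 2 * (Real.log T.det - Real.log S.det) +
        1 / 2 * (x ⬝ᵥ T⁻¹ *ᵥ x) - 1 / 2 * (x ⬝ᵥ S⁻¹ *ᵥ x) := by
  have hSd := hS.det_pos
  have hTd := hT.det_pos
  have := isProbabilityMeasure_mvGaussian hS
  have h1 : (mvGaussian 0 S).rnDeriv (mvGaussian 0 T) =ᵐ[volume] _ :=
    Measure.rnDeriv_withDensity_right (mvGaussian 0 S) volume (by fun_prop)
      (Filter.Eventually.of_forall fun x => by positivity)
      (Filter.Eventually.of_forall fun x => ENNReal.ofReal_ne_top)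
  have h2 : (mvGaussian 0 S).rnDeriv volume =ᵐ[volume] _ :=
    Measure.rnDeriv_withDensity volume (by fun_prop)
  refine (withDensity_absolutelyContinuous volume _ : mvGaussian 0 S ≪ volume).ae_le ?_
  filter_upwards [h1, h2] with x hx1 hx2
  rw [llr, hx1, hx2, ENNReal.toReal_mul, ENNReal.toReal_inv, ENNReal.toReal_ofReal (by positivity),
    ENNReal.toReal_ofReal (by positivity), sub_zero,
    Real.log_mul (by positivity) (by positivity), Real.log_inv,
    Real.log_mul (by positivity) (by positivity), Real.log_mul (by positivity) (by positivity),
    Real.log_exp, Real.log_exp, one_div (√_), one_div (√_), Real.log_inv, Real.log_inv,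
    Real.log_sqrt (by positivity), Real.log_sqrt (by positivity),
    Real.log_mul (by positivity) (by positivity), Real.log_mul (by positivity) (by positivity)]
  ring

theorem integral_llr_mvGaussian {n : ℕ} {S T : Matrix (Fin n) (Fin n) ℝ} (hS : S.PosDef)
    (hT : T.PosDef) :
    ∫ x, llr (mvGaussian 0 S) (mvGaussian 0 T) x ∂(mvGaussian 0 S) =
      1 / 2 * (Real.log T.det - Real.log S.det + (T⁻¹ * S).trace - n) := by
  have := isProbabilityMeasure_mvGaussian hS
  have hT' := (integrable_quadratic_mvGaussian hS T⁻¹).const_mul (1 / 2)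
  have hS' := (integrable_quadratic_mvGaussian hS S⁻¹).const_mul (1 / 2)
  rw [integral_congr_ae (llr_mvGaussian hS hT),
    integral_sub (by exact (integrable_const _).add hT') hS', integral_add (integrable_const _) hT',
    integral_const, integral_const_mul, integral_const_mul, integral_quadratic_mvGaussian hS,
    integral_quadratic_mvGaussian hS,
    nonsing_inv_mul _ hS.det_pos.ne'.isUnit]
  simp
  ring

/-- The whitening matrix of an AR(1) process with gain `a` which is reset just before the
time index `τ` (indices start at `0`). -/
def resetWhitening (a : ℝ) (n τ : ℕ) : Matrix (Fin n) (Fin n) ℝ :=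
  of fun i j => if i = j then 1 else if (j : ℕ) + 1 = i ∧ (i : ℕ) ≠ τ then -a else 0

theorem sum_resetWhitening_mul (a : ℝ) (n τ : ℕ) (g : ℕ → ℝ) (i : Fin n) :
    ∑ k, resetWhitening a n τ i k * g k =
      g i - if (i : ℕ) = 0 ∨ (i : ℕ) = τ then 0 else a * g (i - 1) := by
  have hsplit (k : Fin n) : resetWhitening a n τ i k * g k = (if k = i then g k else 0) +
      (if (k : ℕ) + 1 = i ∧ (i : ℕ) ≠ τ then -a * g k else 0) := by
    simp only [resetWhitening, of_apply]
    by_cases h : i = k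
    · subst h; simp
    · simp [h, Ne.symm h]
  simp only [hsplit, Finset.sum_add_distrib, Finset.sum_ite_eq', Finset.mem_univ, if_true]
  rw [sub_eq_add_neg]
  congr 1
  split_ifs with h
  · rw [neg_zero]
    refine Finset.sum_eq_zero fun k _ => if_neg ?_
    omega
  · rw [Finset.sum_eq_single ⟨(i : ℕ) - 1, by omega⟩]
    · rw [if_pos (by simp only; omega)]
      ring
    · intro k _ hk
      refine if_neg fun hk' => hk (Fin.ext ?_)
      simp only
      omega
    · simp

theorem resetWhitening_conj_apply (a : ℝ) (n τ : ℕ) (s : ℕ → ℕ → ℝ) (i j : Fin n) :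
    (resetWhitening a n τ * of (fun i j : Fin n => s i j) * (resetWhitening a n τ)ᵀ) i j =
      (s i j - if (i : ℕ) = 0 ∨ (i : ℕ) = τ then 0 else a * s (i - 1) j) -
        if (j : ℕ) = 0 ∨ (j : ℕ) = τ then 0 else
          a * (s i (j - 1) - if (i : ℕ) = 0 ∨ (i : ℕ) = τ then 0 else a * s (i - 1) (j - 1)) := by
  rw [← sum_resetWhitening_mul a n τ
    (fun l => s i l - if (i : ℕ) = 0 ∨ (i : ℕ) = τ then 0 else a * s (i - 1) l) j, mul_apply]
  refine Finset.sum_congr rfl fun l _ => ?_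
  rw [transpose_apply, mul_comm, mul_apply]
  simp only [of_apply]
  rw [sum_resetWhitening_mul a n τ (fun k => s k l) i]

theorem det_resetWhitening (a : ℝ) (n τ : ℕ) : (resetWhitening a n τ).det = 1 := by
  rw [det_of_isLowerTriangular]
  · simp [resetWhitening]
  · intro i j hij
    have hij' : i < j := hij
    have : ¬ i = j := hij'.ne
    simp only [resetWhitening, of_apply, this, if_false]
    refine if_neg ?_
    have := Fin.lt_def.mp hij'
    omega

/-- The entries of the covariance matrix of an AR(1) process with gain `a` and stationary
variance `v` which is reset just before the time index `τ`. -/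
def resetCov (a v : ℝ) (τ i j : ℕ) : ℝ :=
  v * if (i < τ ↔ j < τ) then a ^ Nat.dist i j else 0

theorem resetWhitening_conj_resetCov (a v : ℝ) (n τ : ℕ) :
    resetWhitening a n τ * of (fun i j : Fin n => resetCov a v τ i j) * (resetWhitening a n τ)ᵀ =
      diagonal fun i : Fin n => if (i : ℕ) = 0 ∨ (i : ℕ) = τ then v else v * (1 - a ^ 2) := by
  ext i j
  rw [resetWhitening_conj_apply, diagonal_apply]
  simp only [Fin.ext_iff]
  generalize (i : ℕ) = i
  generalize (j : ℕ) = j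
  simp only [resetCov]
  rcases lt_trichotomy i j with h | rfl | h
  · obtain ⟨d, rfl⟩ := Nat.exists_eq_add_of_lt h
    have e1 : Nat.dist i (i + d + 1) = d + 1 := by simp only [Nat.dist]; omega
    have e2 : Nat.dist i (i + d + 1 - 1) = d := by simp only [Nat.dist]; omega
    rcases i with _ | i
    · simp only [e1, e2, true_or, if_true]
      split_ifs <;> first | ring1 | (exfalso; grind)
    · have e3 : Nat.dist (i + 1 - 1) (i + 1 + d + 1) = d + 2 := by simp only [Nat.dist]; omega
      have e4 : Nat.dist (i + 1 - 1) (i + 1 + d + 1 - 1) = d + 1 := by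
        simp only [Nat.dist]; omega
      simp only [e1, e2, e3, e4]
      split_ifs <;> first | ring1 | (exfalso; grind)
  · rcases i with _ | i
    · simp
    · have e1 : Nat.dist (i + 1 - 1) (i + 1) = 1 := by simp only [Nat.dist]; omega
      have e2 : Nat.dist (i + 1) (i + 1 - 1) = 1 := by simp only [Nat.dist]; omega
      simp only [e1, e2, Nat.dist_self]
      split_ifs <;> first | ring1 | (exfalso; grind)
  · obtain ⟨d, rfl⟩ := Nat.exists_eq_add_of_lt h
    have e1 : Nat.dist (j + d + 1) j = d + 1 := by simp only [Nat.dist]; omega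
    have e2 : Nat.dist (j + d + 1 - 1) j = d := by simp only [Nat.dist]; omega
    rcases j with _ | j
    · simp only [e1, e2, true_or, if_true]
      split_ifs <;> first | ring1 | (exfalso; grind)
    · have e3 : Nat.dist (j + 1 + d + 1) (j + 1 - 1) = d + 2 := by simp only [Nat.dist]; omega
      have e4 : Nat.dist (j + 1 + d + 1 - 1) (j + 1 - 1) = d + 1 := by
        simp only [Nat.dist]; omega
      simp only [e1, e2, e3, e4]
      split_ifs <;> first | ring1 | (exfalso; grind)

theorem resetWhitening_conj_stationary_diag (a v : ℝ) (n τ : ℕ) (i : Fin n) :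
    (resetWhitening a n τ * of (fun i j : Fin n => resetCov a v 0 i j) *
        (resetWhitening a n τ)ᵀ) i i =
      if (i : ℕ) = 0 ∨ (i : ℕ) = τ then v else v * (1 - a ^ 2) := by
  rw [resetWhitening_conj_apply]
  generalize (i : ℕ) = i
  simp only [resetCov]
  rcases i with _ | i
  · simp
  · have e1 : Nat.dist (i + 1 - 1) (i + 1) = 1 := by simp only [Nat.dist]; omega
    have e2 : Nat.dist (i + 1) (i + 1 - 1) = 1 := by simp only [Nat.dist]; omega
    simp only [e1, e2, Nat.dist_self]
    split_ifs <;> first | ring1 | (exfalso; grind)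

theorem posDef_resetCov {a v : ℝ} (ha : a ^ 2 < 1) (hv : 0 < v) (n τ : ℕ) :
    (of fun i j : Fin n => resetCov a v τ i j).PosDef := by
  have hU : IsUnit (resetWhitening a n τ) := by simp [isUnit_iff_isUnit_det, det_resetWhitening]
  rw [← IsUnit.posDef_star_right_conjugate_iff hU, star_eq_conjTranspose,
    conjTranspose_eq_transpose_of_trivial, resetWhitening_conj_resetCov, posDef_diagonal_iff]
  intro i
  have : 0 < 1 - a ^ 2 := by linarith
  split_ifs <;> positivity

theorem det_resetCov (a v : ℝ) (n τ : ℕ) :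
    (of fun i j : Fin n => resetCov a v τ i j).det =
      ∏ i : Fin n, if (i : ℕ) = 0 ∨ (i : ℕ) = τ then v else v * (1 - a ^ 2) := by
  rw [← det_diagonal, ← resetWhitening_conj_resetCov, det_mul, det_mul, det_transpose,
    det_resetWhitening, one_mul, mul_one]

theorem trace_inv_resetCov_mul {a v : ℝ} (ha : a ^ 2 < 1) (hv : 0 < v) (n τ : ℕ) :
    ((of fun i j : Fin n => resetCov a v τ i j)⁻¹ *
      of fun i j : Fin n => resetCov a v 0 i j).trace = n := by
  have hU : IsUnit (resetWhitening a n τ).det := by simp [det_resetWhitening]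
  have hUt : IsUnit (resetWhitening a n τ)ᵀ.det := by simp [det_resetWhitening]
  have ha' : 1 - a ^ 2 ≠ 0 := by linarith
  have hinv := congrArg (fun M => (resetWhitening a n τ)ᵀ * M⁻¹ * resetWhitening a n τ)
    (resetWhitening_conj_resetCov a v n τ)
  simp only [Matrix.mul_inv_rev] at hinv
  rw [← Matrix.mul_assoc, mul_nonsing_inv _ hUt, Matrix.one_mul, Matrix.mul_assoc,
    nonsing_inv_mul _ hU, Matrix.mul_one] at hinv
  rw [hinv, Matrix.mul_assoc, Matrix.mul_assoc, trace_mul_comm, Matrix.mul_assoc,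
    inv_diagonal, trace]
  simp only [diag_apply, diagonal_mul, resetWhitening_conj_stationary_diag]
  have hd : IsUnit (fun i : Fin n => if (i : ℕ) = 0 ∨ (i : ℕ) = τ then v else v * (1 - a ^ 2)) := by
    rw [Pi.isUnit_iff]
    intro i
    split_ifs <;> simp [hv.ne', ha']
  have hone := Ring.inverse_mul_cancel _ hd
  have (i : Fin n) := congrFun hone i
  simp only [Pi.mul_apply, Pi.one_apply] at this
  simp [this]

theorem det_resetCov_eq {a v : ℝ} (ha : a ^ 2 < 1) {n τ : ℕ} (hτ : 1 ≤ τ) (hτn : τ < n) :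
    (of fun i j : Fin n => resetCov a v τ i j).det =
      1 / (1 - a ^ 2) * (of fun i j : Fin n => resetCov a v 0 i j).det := by
  have ha' : 1 - a ^ 2 ≠ 0 := by linarith
  have hmem : (⟨τ, hτn⟩ : Fin n) ∈ Finset.univ := Finset.mem_univ _
  rw [det_resetCov, det_resetCov, ← Finset.mul_prod_erase _ _ hmem,
    ← Finset.mul_prod_erase _ _ hmem,
    ← mul_assoc]
  have h0 : ¬ (τ = 0 ∨ τ = 0) := by omega
  congr 1
  · simp only [h0, or_true, if_true, if_false]
    field_simp
  · refine Finset.prod_congr rfl fun i hi => ?_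
    have : (i : ℕ) ≠ τ := fun h => (Finset.mem_erase.mp hi).1 (Fin.ext h)
    simp [this]

/-- Let `Σ = σ²/(1-a²) Â_n` be the steady-state covariance matrix of
`n` samples of a stationary Gaussian AR(1) process with gain `a`, `0 < |a| < 1`, and let
`Σ̃ = σ²/(1-a²) diag(Â_τ, Â_{n-τ})` be the covariance of the process reset right after
time `τ`.  Then `Σ` and `Σ̃` are positive definite and
`D_KL(N(0,Σ) ‖ N(0,Σ̃)) = ½ log(1/(1-a²))`, independently of `τ` and `n`. -/
theorem klDiv_reset_ar1 (a σ : ℝ) (ha0 : 0 < |a|) (ha1 : |a| < 1) (hσ : 0 < σ)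
    (n τ : ℕ) (hn : 2 ≤ n) (hτ1 : 1 ≤ τ) (hτ2 : τ ≤ n - 1)
    (S St : Matrix (Fin n) (Fin n) ℝ)
    (hS : ∀ i j : Fin n, S i j = σ ^ 2 / (1 - a ^ 2) * a ^ Nat.dist (i : ℕ) (j : ℕ))
    (hSt : ∀ i j : Fin n, St i j = σ ^ 2 / (1 - a ^ 2) *
      (if ((i : ℕ) < τ ↔ (j : ℕ) < τ) then a ^ Nat.dist (i : ℕ) (j : ℕ) else 0)) :
    S.PosDef ∧ St.PosDef ∧
      ∫ x, llr (mvGaussian 0 S) (mvGaussian 0 St) x ∂(mvGaussian 0 S) =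
        (1 / 2) * Real.log (1 / (1 - a ^ 2)) := by
  have ha : a ^ 2 < 1 := (sq_lt_one_iff_abs_lt_one a).mpr ha1
  have ha' : 0 < 1 - a ^ 2 := by linarith
  have hv : 0 < σ ^ 2 / (1 - a ^ 2) := by positivity
  have hτn : τ < n := by omega
  obtain rfl : S = of fun i j : Fin n => resetCov a (σ ^ 2 / (1 - a ^ 2)) 0 i j := by
    ext i j
    simp [hS, resetCov]
  obtain rfl : St = of fun i j : Fin n => resetCov a (σ ^ 2 / (1 - a ^ 2)) τ i j := by
    ext i j
    simp only [hSt, resetCov, of_apply]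
  have hSpos := posDef_resetCov ha hv n 0
  have hStpos := posDef_resetCov ha hv n τ
  refine ⟨hSpos, hStpos, ?_⟩
  rw [integral_llr_mvGaussian hSpos hStpos, trace_inv_resetCov_mul ha hv, det_resetCov_eq ha hτ1 hτn,
    Real.log_mul (by positivity) hSpos.det_pos.ne']
  ring
end

section
/- Let a, b, σ_Z ∈ ℝ with 0 < |a| < |b| < 1, sgn(a) = sgn(b), σ_Z > 0, let ε > 0, and let n ≥ 1 satisfy n < 2b/(b − a). Let Σ₀ and Σ₁ be the n×n matrices with entries [Σ₀]_{ij} = (σ_Z²/(1 − a²))·a^{|i−j|} and [Σ₁]_{ij} = (σ_Z²/(1 − b²))·b^{|i−j|}. If |b| < √(1 − (1 − a²)·e^{−4ε²}), then the total variation distance between the centered multivariate Gaussians N(0, Σ₀) and N(0, Σ₁) is at most ε; consequently, for any binary hypothesis test between them the error probabilities satisfy α + β ≥ 1 − ε, i.e. Alice achieves ε-covertness. -/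
open Matrix MeasureTheory

/-- The total variation distance between two measures:
`V_T(P, Q) = sup { |P(B) - Q(B)| : B measurable }`. -/
noncomputable def tvDist {Ω : Type*} [MeasurableSpace Ω] (P Q : Measure Ω) : ℝ :=
  sSup {x : ℝ | ∃ B : Set Ω, MeasurableSet B ∧ x = |(P B).toReal - (Q B).toReal|}

section Auxiliary

open ProbabilityTheory InformationTheory

/-- **Pinsker's inequality** for a single event. -/
lemma two_mul_sq_measureReal_sub_le_integral_llr {Ω : Type*} [MeasurableSpace Ω]
    {P Q : Measure Ω} [IsProbabilityMeasure P] [IsProbabilityMeasure Q]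
    (hPQ : P ≪ Q) (hint : Integrable (llr P Q) P) {B : Set Ω} (hB : MeasurableSet B) :
    2 * (P.real B - Q.real B) ^ 2 ≤ ∫ x, llr P Q x ∂P := by
  set t : ℝ := 4 * (P.real B - Q.real B) with ht
  set X : Ω → ℝ := B.indicator 1 with hX
  have hXm : Measurable X := measurable_const.indicator hB
  have hXmem : ∀ ω, X ω ∈ Set.Icc (0 : ℝ) 1 := fun ω ↦ by
    by_cases h : ω ∈ B <;> simp [hX, h]
  have hXP : ∫ ω, X ω ∂P = P.real B := integral_indicator_one hB
  have hXQ : ∫ ω, X ω ∂Q = Q.real B := integral_indicator_one hB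
  have hXintP : Integrable X P :=
    Integrable.of_mem_Icc 0 1 hXm.aemeasurable (Filter.Eventually.of_forall hXmem)
  have hexpQ : Integrable (fun ω ↦ Real.exp (t * X ω)) Q :=
    integrable_exp_mul_of_mem_Icc hXm.aemeasurable (Filter.Eventually.of_forall hXmem)
  have hsub := (hasSubgaussianMGF_of_mem_Icc (μ := Q) hXm.aemeasurable
    (Filter.Eventually.of_forall hXmem)).mgf_le t
  have hmgf : mgf (fun ω ↦ X ω - Q[X]) Q t
      = Real.exp (-(t * Q.real B)) * ∫ ω, Real.exp (t * X ω) ∂Q := by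
    rw [mgf, ← integral_const_mul]
    refine integral_congr_ae (Filter.Eventually.of_forall fun ω ↦ ?_)
    simp only [hXQ, ← Real.exp_add]
    ring_nf
  rw [hmgf] at hsub
  have hpos : 0 < ∫ ω, Real.exp (t * X ω) ∂Q := integral_exp_pos hexpQ
  have hlog := Real.log_le_log (by positivity) hsub
  rw [Real.log_exp, Real.log_mul (Real.exp_ne_zero _) hpos.ne', Real.log_exp] at hlog
  have hQt : IsProbabilityMeasure (Q.tilted fun ω ↦ t * X ω) := isProbabilityMeasure_tilted hexpQ
  have hgibbs := integral_llr_add_sub_measure_univ_nonneg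
    (hPQ.trans (absolutelyContinuous_tilted hexpQ))
    (integrable_llr_tilted_right hPQ (hXintP.const_mul t) hint hexpQ)
  rw [integral_llr_tilted_right hPQ (hXintP.const_mul t) hexpQ hint, integral_const_mul, hXP]
    at hgibbs
  norm_num at hlog hgibbs
  nlinarith

/-- The density of the centered Gaussian with covariance matrix `S`. -/
noncomputable def centeredGaussianDensity {n : ℕ} (S : Matrix (Fin n) (Fin n) ℝ)
    (x : Fin n → ℝ) : ℝ :=
  (1 / √((2 * Real.pi) ^ n * S.det)) * Real.exp (-(1 / 2) * (x ⬝ᵥ S⁻¹ *ᵥ x))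

lemma mvGaussian_zero_eq {n : ℕ} (S : Matrix (Fin n) (Fin n) ℝ) :
    mvGaussian 0 S = volume.withDensity fun x ↦ ENNReal.ofReal (centeredGaussianDensity S x) := by
  simp only [mvGaussian, centeredGaussianDensity, sub_zero]

lemma measurable_mulVec {n : ℕ} (A : Matrix (Fin n) (Fin n) ℝ) :
    Measurable (A *ᵥ · : (Fin n → ℝ) → Fin n → ℝ) :=
  (continuous_const.matrix_mulVec continuous_id).measurable

lemma measurable_centeredGaussianDensity {n : ℕ} (S : Matrix (Fin n) (Fin n) ℝ) :
    Measurable (centeredGaussianDensity S) :=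
  (Real.measurable_exp.comp ((continuous_id.dotProduct
    (continuous_const.matrix_mulVec continuous_id)).measurable.const_mul _)).const_mul _

lemma centeredGaussianDensity_pos {n : ℕ} {S : Matrix (Fin n) (Fin n) ℝ} (hS : 0 < S.det)
    (x : Fin n → ℝ) : 0 < centeredGaussianDensity S x := by
  unfold centeredGaussianDensity
  positivity

lemma pi_gaussianReal_eq_mvGaussian (n : ℕ) :
    Measure.pi (fun _ : Fin n ↦ gaussianReal 0 1) = mvGaussian 0 1 := by
  refine Measure.pi_eq fun s hs ↦ ?_
  have hdens : ∀ x : Fin n → ℝ,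
      centeredGaussianDensity 1 x = ∏ i, gaussianPDFReal 0 1 (x i) := by
    intro x
    simp only [centeredGaussianDensity, gaussianPDFReal, Finset.prod_mul_distrib, ← Real.exp_sum]
    congr 1
    · rw [det_one, mul_one, Finset.prod_const, Finset.card_univ, Fintype.card_fin, one_div,
        inv_pow, NNReal.coe_one, mul_one]
      congr 1
      rw [Real.sqrt_eq_iff_mul_self_eq (by positivity) (by positivity), ← mul_pow,
        Real.mul_self_sqrt (by positivity)]
    · simp [dotProduct, Finset.mul_sum]
      simp only [← Finset.sum_neg_distrib]
      exact Finset.sum_congr rfl fun i _ ↦ by ring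
  rw [mvGaussian_zero_eq, withDensity_apply _ (MeasurableSet.univ_pi hs)]
  simp_rw [hdens]
  rw [volume_pi, Measure.restrict_pi_pi, ← ofReal_integral_eq_lintegral_ofReal
    (Integrable.fintype_prod fun i ↦ (integrable_gaussianPDFReal 0 1).restrict)
    (Filter.Eventually.of_forall fun x ↦
      Finset.prod_nonneg fun i _ ↦ gaussianPDFReal_nonneg 0 1 _),
    integral_fintype_prod_eq_prod (f := fun _ ↦ gaussianPDFReal 0 1),
    ENNReal.ofReal_prod_of_nonneg fun i _ ↦
      integral_nonneg fun x ↦ gaussianPDFReal_nonneg 0 1 x]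
  exact Finset.prod_congr rfl fun i _ ↦
    (gaussianReal_apply_eq_integral 0 one_ne_zero (s i)).symm

section Whitening

variable {n : ℕ} {A S : Matrix (Fin n) (Fin n) ℝ}

lemma det_sq_mul_det_of_whitening (h : A * S * Aᵀ = 1) : A.det ^ 2 * S.det = 1 := by
  have := congrArg det h
  simp only [det_mul, det_transpose, det_one] at this
  linarith

lemma det_ne_zero_of_whitening (h : A * S * Aᵀ = 1) : A.det ≠ 0 := by
  intro h0
  simpa [h0] using det_sq_mul_det_of_whitening h

lemma det_pos_of_whitening (h : A * S * Aᵀ = 1) : 0 < S.det := by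
  have h1 := det_sq_mul_det_of_whitening h
  have h2 : 0 < A.det ^ 2 := by have := det_ne_zero_of_whitening h; positivity
  exact pos_of_mul_pos_right (h1 ▸ one_pos) h2.le

lemma eq_of_whitening (h : A * S * Aᵀ = 1) : S = A⁻¹ * A⁻¹ᵀ := by
  have hA : IsUnit A.det := (det_ne_zero_of_whitening h).isUnit
  have hAt : IsUnit Aᵀ.det := by rwa [det_transpose]
  calc S = A⁻¹ * (A * S * Aᵀ) * Aᵀ⁻¹ := by
        rw [mul_assoc A, nonsing_inv_mul_cancel_left _ _ hA, mul_nonsing_inv_cancel_right _ _ hAt]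
    _ = A⁻¹ * A⁻¹ᵀ := by rw [h, mul_one, transpose_nonsing_inv]

lemma inv_eq_of_whitening (h : A * S * Aᵀ = 1) : S⁻¹ = Aᵀ * A := by
  have hA : IsUnit A.det := (det_ne_zero_of_whitening h).isUnit
  rw [eq_of_whitening h, Matrix.mul_inv_rev, transpose_nonsing_inv, nonsing_inv_nonsing_inv _ hA,
    nonsing_inv_nonsing_inv _ (by rwa [det_transpose])]

lemma map_mulVec_mvGaussian (h : A * S * Aᵀ = 1) :
    (mvGaussian 0 S).map (A *ᵥ ·) = mvGaussian 0 1 := by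
  have hA := det_ne_zero_of_whitening h
  have hmeas := measurable_mulVec A
  have hdens : ∀ x : Fin n → ℝ, ENNReal.ofReal (centeredGaussianDensity S x)
      = ENNReal.ofReal |A.det| * ENNReal.ofReal (centeredGaussianDensity 1 (A *ᵥ x)) := by
    intro x
    have hS : S.det = (|A.det|⁻¹) ^ 2 := by
      rw [inv_pow, sq_abs]
      exact eq_inv_of_mul_eq_one_right (det_sq_mul_det_of_whitening h)
    rw [← ENNReal.ofReal_mul (abs_nonneg _), centeredGaussianDensity, centeredGaussianDensity,
      ← mul_assoc, hS,
      Real.sqrt_mul (by positivity), Real.sqrt_sq (by positivity), inv_eq_of_whitening h,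
      ← mulVec_mulVec, dotProduct_mulVec _ Aᵀ, vecMul_transpose]
    simp [mul_comm]
  have hvol : volume.map (A *ᵥ ·) = ENNReal.ofReal |A.det⁻¹| • (volume : Measure (Fin n → ℝ)) :=
    Real.map_matrix_volume_pi_eq_smul_volume_pi hA
  ext s hs
  rw [Measure.map_apply hmeas hs, mvGaussian_zero_eq, mvGaussian_zero_eq, withDensity_apply _ (hmeas hs),
    withDensity_apply _ hs]
  simp_rw [hdens]
  have hg := (measurable_centeredGaussianDensity (1 : Matrix (Fin n) (Fin n) ℝ)).ennreal_ofReal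
  rw [lintegral_const_mul _ (by exact hg.comp hmeas), ← setLIntegral_map hs hg hmeas, hvol,
    Measure.restrict_smul, lintegral_smul_measure, smul_eq_mul, ← mul_assoc,
    ← ENNReal.ofReal_mul (abs_nonneg _), ← abs_mul, mul_inv_cancel₀ hA]
  simp

lemma measurePreserving_mulVec_mvGaussian (h : A * S * Aᵀ = 1) :
    MeasurePreserving (A *ᵥ ·) (mvGaussian 0 S)
      (Measure.pi (fun _ : Fin n ↦ gaussianReal 0 1)) where
  measurable := measurable_mulVec A
  map_eq := by rw [map_mulVec_mvGaussian h, pi_gaussianReal_eq_mvGaussian]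

lemma isProbabilityMeasure_mvGaussian_s15 (h : A * S * Aᵀ = 1) :
    IsProbabilityMeasure (mvGaussian 0 S) :=
  ⟨by
    have hmp := measurePreserving_mulVec_mvGaussian h
    simpa using hmp.measure_preimage MeasurableSet.univ.nullMeasurableSet⟩

end Whitening

section QuadraticForm

lemma integrable_eval_mul_eval_pi_gaussianReal {n : ℕ} (i j : Fin n) :
    Integrable (fun y : Fin n → ℝ ↦ y i * y j) (Measure.pi fun _ ↦ gaussianReal 0 1) := by
  have hmem : ∀ i : Fin n,
      MemLp (fun y : Fin n → ℝ ↦ y i) 2 (Measure.pi fun _ ↦ gaussianReal 0 1) := fun i ↦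
    (IsGaussian.memLp_two_id (μ := gaussianReal 0 1)).comp_measurePreserving
      (measurePreserving_eval (fun _ : Fin n ↦ gaussianReal 0 1) i)
  exact (hmem i).integrable_mul (hmem j)

lemma integral_eval_mul_eval_pi_gaussianReal {n : ℕ} (i j : Fin n) :
    ∫ y : Fin n → ℝ, y i * y j ∂(Measure.pi fun _ ↦ gaussianReal 0 1)
      = (1 : Matrix (Fin n) (Fin n) ℝ) i j := by
  rcases eq_or_ne i j with rfl | hij
  · rw [one_apply_eq, integral_comp_eval (μ := fun _ : Fin n ↦ gaussianReal 0 1) (i := i)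
      (f := fun x : ℝ ↦ x * x) (by fun_prop)]
    have h := variance_of_integral_eq_zero (μ := gaussianReal 0 1) (X := id) (by fun_prop)
      (by simp)
    rw [variance_id_gaussianReal] at h
    simpa [sq] using h.symm
  · have hind : IndepFun (fun y : Fin n → ℝ ↦ y i) (fun y ↦ y j)
        (Measure.pi fun _ ↦ gaussianReal 0 1) :=
      (iIndepFun_pi (μ := fun _ : Fin n ↦ gaussianReal 0 1) (X := fun _ ↦ id)
        fun i ↦ aemeasurable_id).indepFun hij
    rw [one_apply_ne hij, hind.integral_fun_mul_eq_mul_integral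
        (measurable_pi_apply i).aestronglyMeasurable (measurable_pi_apply j).aestronglyMeasurable,
      integral_comp_eval (μ := fun _ : Fin n ↦ gaussianReal 0 1) (i := i)
      (f := fun x : ℝ ↦ x) (by fun_prop)]
    simp

lemma integrable_dotProduct_mulVec_pi_gaussianReal {n : ℕ} (N : Matrix (Fin n) (Fin n) ℝ) :
    Integrable (fun y : Fin n → ℝ ↦ y ⬝ᵥ N *ᵥ y) (Measure.pi fun _ ↦ gaussianReal 0 1) := by
  simp only [dotProduct, mulVec, Finset.mul_sum, mul_left_comm _ (N _ _)]
  exact integrable_finsetSum _ fun i _ ↦ integrable_finsetSum _ fun j _ ↦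
    (integrable_eval_mul_eval_pi_gaussianReal i j).const_mul _

lemma integral_dotProduct_mulVec_pi_gaussianReal {n : ℕ} (N : Matrix (Fin n) (Fin n) ℝ) :
    ∫ y : Fin n → ℝ, y ⬝ᵥ N *ᵥ y ∂(Measure.pi fun _ ↦ gaussianReal 0 1) = N.trace := by
  simp only [dotProduct, mulVec, Finset.mul_sum, mul_left_comm _ (N _ _)]
  refine (integral_finsetSum _ fun i _ ↦ integrable_finsetSum _ fun j _ ↦
    (integrable_eval_mul_eval_pi_gaussianReal i j).const_mul _).trans ?_
  refine Finset.sum_congr rfl fun i _ ↦ ?_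
  rw [integral_finsetSum _ fun j _ ↦ (integrable_eval_mul_eval_pi_gaussianReal i j).const_mul _]
  simp [integral_const_mul, integral_eval_mul_eval_pi_gaussianReal, one_apply]

variable {n : ℕ} {A S : Matrix (Fin n) (Fin n) ℝ}

lemma dotProduct_mulVec_eq_whitened (h : A * S * Aᵀ = 1) (M : Matrix (Fin n) (Fin n) ℝ)
    (x : Fin n → ℝ) :
    x ⬝ᵥ M *ᵥ x = (A *ᵥ x) ⬝ᵥ (A⁻¹ᵀ * M * A⁻¹) *ᵥ (A *ᵥ x) := by
  have hA : IsUnit A.det := (det_ne_zero_of_whitening h).isUnit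
  rw [mulVec_mulVec, nonsing_inv_mul_cancel_right _ _ hA, ← vecMul_transpose A x,
    ← dotProduct_mulVec, mulVec_mulVec, ← mul_assoc, ← transpose_mul, nonsing_inv_mul _ hA,
    transpose_one, one_mul]

lemma integrable_dotProduct_mulVec_mvGaussian (h : A * S * Aᵀ = 1)
    (M : Matrix (Fin n) (Fin n) ℝ) :
    Integrable (fun x ↦ x ⬝ᵥ M *ᵥ x) (mvGaussian 0 S) := by
  simp_rw [dotProduct_mulVec_eq_whitened h M]
  have hN := integrable_dotProduct_mulVec_pi_gaussianReal (A⁻¹ᵀ * M * A⁻¹)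
  rw [← (measurePreserving_mulVec_mvGaussian h).map_eq] at hN
  exact hN.comp_measurable (measurable_mulVec A)

lemma integral_dotProduct_mulVec_mvGaussian (h : A * S * Aᵀ = 1)
    (M : Matrix (Fin n) (Fin n) ℝ) :
    ∫ x, x ⬝ᵥ M *ᵥ x ∂(mvGaussian 0 S) = (M * S).trace := by
  have hmp := measurePreserving_mulVec_mvGaussian h
  simp_rw [dotProduct_mulVec_eq_whitened h M]
  rw [← integral_map (f := fun y : Fin n → ℝ ↦ y ⬝ᵥ (A⁻¹ᵀ * M * A⁻¹) *ᵥ y)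
    hmp.measurable.aemeasurable
    (hmp.map_eq ▸ (integrable_dotProduct_mulVec_pi_gaussianReal _).aestronglyMeasurable),
    hmp.map_eq, integral_dotProduct_mulVec_pi_gaussianReal, mul_assoc, trace_mul_comm,
    eq_of_whitening h, mul_assoc]

end QuadraticForm

section KullbackLeibler

variable {n : ℕ} {A₀ A₁ S₀ S₁ : Matrix (Fin n) (Fin n) ℝ}

lemma mvGaussian_eq_withDensity (h₁ : 0 < S₁.det) :
    mvGaussian 0 S₀ = (mvGaussian 0 S₁).withDensity fun x ↦
      ENNReal.ofReal (centeredGaussianDensity S₀ x / centeredGaussianDensity S₁ x) := by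
  rw [mvGaussian_zero_eq S₁, ← withDensity_mul _
    (measurable_centeredGaussianDensity S₁).ennreal_ofReal
    ((measurable_centeredGaussianDensity S₀).fun_div
      (measurable_centeredGaussianDensity S₁)).ennreal_ofReal, mvGaussian_zero_eq]
  congr 1
  ext x
  have hx := centeredGaussianDensity_pos h₁ x
  rw [Pi.mul_apply, ← ENNReal.ofReal_mul hx.le, mul_div_cancel₀ _ hx.ne']

lemma mvGaussian_absolutelyContinuous (h₁ : 0 < S₁.det) :
    mvGaussian 0 S₀ ≪ mvGaussian 0 S₁ := by
  rw [mvGaussian_eq_withDensity h₁]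
  exact withDensity_absolutelyContinuous _ _

lemma llr_mvGaussian_s15 (h₀ : A₀ * S₀ * A₀ᵀ = 1) (h₁ : A₁ * S₁ * A₁ᵀ = 1) :
    llr (mvGaussian 0 S₀) (mvGaussian 0 S₁) =ᵐ[mvGaussian 0 S₀] fun x ↦
      Real.log (S₁.det / S₀.det) / 2 + (x ⬝ᵥ S₁⁻¹ *ᵥ x - x ⬝ᵥ S₀⁻¹ *ᵥ x) / 2 := by
  have hd₀ := det_pos_of_whitening h₀
  have hd₁ := det_pos_of_whitening h₁
  have := isProbabilityMeasure_mvGaussian_s15 h₁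
  have hrn := Measure.rnDeriv_withDensity (mvGaussian 0 S₁)
    ((measurable_centeredGaussianDensity S₀).fun_div
      (measurable_centeredGaussianDensity S₁)).ennreal_ofReal
  rw [← mvGaussian_eq_withDensity hd₁] at hrn
  filter_upwards [(mvGaussian_absolutelyContinuous hd₁).ae_le hrn] with x hx
  have hx₀ := centeredGaussianDensity_pos hd₀ x
  have hx₁ := centeredGaussianDensity_pos hd₁ x
  rw [llr_def]
  dsimp only
  rw [hx, ENNReal.toReal_ofReal (by positivity), Real.log_div hx₀.ne' hx₁.ne',
    centeredGaussianDensity, centeredGaussianDensity,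
    Real.log_mul (by positivity) (by positivity), Real.log_mul (by positivity) (by positivity),
    Real.log_exp, Real.log_exp, Real.log_div one_ne_zero (by positivity),
    Real.log_div one_ne_zero (by positivity), Real.log_one,
    Real.log_sqrt (by positivity), Real.log_sqrt (by positivity),
    Real.log_mul (by positivity) hd₀.ne', Real.log_mul (by positivity) hd₁.ne',
    Real.log_div hd₁.ne' hd₀.ne']
  ring

lemma integrable_llr_mvGaussian (h₀ : A₀ * S₀ * A₀ᵀ = 1) (h₁ : A₁ * S₁ * A₁ᵀ = 1) :
    Integrable (llr (mvGaussian 0 S₀) (mvGaussian 0 S₁)) (mvGaussian 0 S₀) := by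
  have := isProbabilityMeasure_mvGaussian_s15 h₀
  rw [integrable_congr (llr_mvGaussian_s15 h₀ h₁)]
  exact (integrable_const _).add (((integrable_dotProduct_mulVec_mvGaussian h₀ _).sub
    (integrable_dotProduct_mulVec_mvGaussian h₀ _)).div_const 2)

/-- The Kullback-Leibler divergence between two nondegenerate centered Gaussians. -/
lemma integral_llr_mvGaussian_s15 (h₀ : A₀ * S₀ * A₀ᵀ = 1) (h₁ : A₁ * S₁ * A₁ᵀ = 1) :
    ∫ x, llr (mvGaussian 0 S₀) (mvGaussian 0 S₁) x ∂(mvGaussian 0 S₀)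
      = (Real.log (S₁.det / S₀.det) + (S₁⁻¹ * S₀).trace - n) / 2 := by
  have := isProbabilityMeasure_mvGaussian_s15 h₀
  have hi₀ := integrable_dotProduct_mulVec_mvGaussian h₀ S₀⁻¹
  have hi₁ := integrable_dotProduct_mulVec_mvGaussian h₀ S₁⁻¹
  rw [integral_congr_ae (llr_mvGaussian_s15 h₀ h₁),
    integral_add (integrable_const _) (by exact (hi₁.sub hi₀).div_const 2), integral_div,
    integral_div,
    integral_sub hi₁ hi₀, integral_dotProduct_mulVec_mvGaussian h₀,
    integral_dotProduct_mulVec_mvGaussian h₀,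
    nonsing_inv_mul _ (det_pos_of_whitening h₀).ne'.isUnit]
  simp
  ring

end KullbackLeibler

section Autoregressive

/-- The matrix mapping a stationary Gaussian AR(1) sample with gain `a` and noise standard deviation
`σ` to its normalized innovations. -/
noncomputable def arWhitening (m : ℕ) (a σ : ℝ) : Matrix (Fin (m + 1)) (Fin (m + 1)) ℝ :=
  of (Fin.cons ((√(1 - a ^ 2) / σ) • Pi.single 0 1)
    fun i : Fin m ↦ σ⁻¹ • (Pi.single i.succ 1 - a • Pi.single i.castSucc 1))

variable {m : ℕ} {a σ : ℝ}

lemma arWhitening_mul_zero (M : Matrix (Fin (m + 1)) (Fin (m + 1)) ℝ) (k : Fin (m + 1)) :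
    (arWhitening m a σ * M) 0 k = √(1 - a ^ 2) / σ * M 0 k := by
  rw [mul_apply']
  change ((√(1 - a ^ 2) / σ) • (Pi.single 0 1 : Fin (m + 1) → ℝ)) ⬝ᵥ _ = _
  simp

lemma arWhitening_mul_succ (M : Matrix (Fin (m + 1)) (Fin (m + 1)) ℝ) (i : Fin m)
    (k : Fin (m + 1)) :
    (arWhitening m a σ * M) i.succ k = σ⁻¹ * (M i.succ k - a * M i.castSucc k) := by
  rw [mul_apply']
  change (σ⁻¹ • ((Pi.single i.succ 1 : Fin (m + 1) → ℝ) - a • Pi.single i.castSucc 1)) ⬝ᵥ _ = _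
  simp [sub_dotProduct]

lemma mul_arWhitening_transpose_zero (M : Matrix (Fin (m + 1)) (Fin (m + 1)) ℝ)
    (k : Fin (m + 1)) :
    (M * (arWhitening m a σ)ᵀ) k 0 = √(1 - a ^ 2) / σ * M k 0 := by
  rw [← transpose_apply (M * _), transpose_mul, transpose_transpose, arWhitening_mul_zero,
    transpose_apply]

lemma mul_arWhitening_transpose_succ (M : Matrix (Fin (m + 1)) (Fin (m + 1)) ℝ) (i : Fin m)
    (k : Fin (m + 1)) :
    (M * (arWhitening m a σ)ᵀ) k i.succ = σ⁻¹ * (M k i.succ - a * M k i.castSucc) := by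
  rw [← transpose_apply (M * _), transpose_mul, transpose_transpose, arWhitening_mul_succ,
    transpose_apply, transpose_apply]

lemma det_arWhitening (hσ : σ ≠ 0) :
    (arWhitening m a σ).det = √(1 - a ^ 2) / σ ^ (m + 1) := by
  have hent : ∀ i j, arWhitening m a σ i j =
      (arWhitening m a σ * (1 : Matrix (Fin (m + 1)) (Fin (m + 1)) ℝ)) i j := by simp
  have htri : (arWhitening m a σ).IsLowerTriangular := by
    intro i j hij
    replace hij : i < j := hij
    rw [hent]
    induction i using Fin.cases with
    | zero => rw [arWhitening_mul_zero, one_apply_ne hij.ne, mul_zero]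
    | succ i =>
      rw [arWhitening_mul_succ, one_apply_ne hij.ne,
        one_apply_ne (Fin.castSucc_lt_succ.trans hij).ne]
      simp
  rw [det_of_isLowerTriangular _ htri, Fin.prod_univ_succ, hent, arWhitening_mul_zero]
  have : ∀ i : Fin m, arWhitening m a σ i.succ i.succ = σ⁻¹ := fun i ↦ by
    rw [hent, arWhitening_mul_succ, one_apply_eq, one_apply_ne Fin.castSucc_lt_succ.ne]
    simp
  simp only [this]
  simp
  field_simp
  ring

lemma arWhitening_mul_mul_transpose (ha : a ^ 2 < 1) (hσ : σ ≠ 0)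
    {S : Matrix (Fin (m + 1)) (Fin (m + 1)) ℝ}
    (hS : ∀ i j, S i j = σ ^ 2 / (1 - a ^ 2) * a ^ Nat.dist (i : ℕ) (j : ℕ)) :
    arWhitening m a σ * S * (arWhitening m a σ)ᵀ = 1 := by
  have h1 : 0 < 1 - a ^ 2 := by linarith
  have hsq : √(1 - a ^ 2) ^ 2 = 1 - a ^ 2 := Real.sq_sqrt h1.le
  ext i j
  induction i using Fin.cases with
  | zero =>
    induction j using Fin.cases with
    | zero =>
      rw [mul_arWhitening_transpose_zero, arWhitening_mul_zero, hS]
      simp [Nat.dist_self]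
      field_simp
      rw [hsq]
    | succ j =>
      rw [mul_arWhitening_transpose_succ, arWhitening_mul_zero, arWhitening_mul_zero, hS, hS,
        one_apply_ne (Fin.succ_ne_zero j).symm]
      simp only [Nat.dist, Fin.val_zero, Fin.val_succ, Fin.val_castSucc, Nat.zero_sub, zero_add,
        Nat.sub_zero, pow_succ]
      ring
  | succ i =>
    induction j using Fin.cases with
    | zero =>
      rw [mul_arWhitening_transpose_zero, arWhitening_mul_succ, hS, hS,
        one_apply_ne (Fin.succ_ne_zero i)]
      simp only [Nat.dist, Fin.val_zero, Fin.val_succ, Fin.val_castSucc, Nat.zero_sub, add_zero,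
        Nat.sub_zero, pow_succ]
      ring
    | succ j =>
      rw [mul_arWhitening_transpose_succ, arWhitening_mul_succ, arWhitening_mul_succ, hS, hS, hS,
        hS]
      simp only [Fin.val_succ, Fin.val_castSucc]
      rcases lt_trichotomy i j with hij | rfl | hij
      · rw [one_apply_ne (by simpa using hij.ne)]
        obtain ⟨d, hd⟩ := Nat.exists_eq_add_of_lt (Fin.lt_def.1 hij)
        have e1 : Nat.dist (i + 1 : ℕ) (j + 1) = d + 1 := by simp only [Nat.dist]; omega
        have e2 : Nat.dist (i : ℕ) (j + 1) = d + 2 := by simp only [Nat.dist]; omega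
        have e3 : Nat.dist (i + 1 : ℕ) j = d := by simp only [Nat.dist]; omega
        have e4 : Nat.dist (i : ℕ) j = d + 1 := by simp only [Nat.dist]; omega
        rw [e1, e2, e3, e4]
        ring
      · have e2 : Nat.dist (i : ℕ) (i + 1) = 1 := by simp only [Nat.dist]; omega
        have e3 : Nat.dist (i + 1 : ℕ) i = 1 := by simp only [Nat.dist]; omega
        rw [e2, e3, one_apply_eq, Nat.dist_self, Nat.dist_self]
        field_simp
        ring
      · rw [one_apply_ne (by simpa using hij.ne')]
        obtain ⟨d, hd⟩ := Nat.exists_eq_add_of_lt (Fin.lt_def.1 hij)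
        have e1 : Nat.dist (i + 1 : ℕ) (j + 1) = d + 1 := by simp only [Nat.dist]; omega
        have e2 : Nat.dist (i : ℕ) (j + 1) = d := by simp only [Nat.dist]; omega
        have e3 : Nat.dist (i + 1 : ℕ) j = d + 2 := by simp only [Nat.dist]; omega
        have e4 : Nat.dist (i : ℕ) j = d + 1 := by simp only [Nat.dist]; omega
        rw [e1, e2, e3, e4]
        ring

lemma det_arCovariance (ha : a ^ 2 < 1) (hσ : σ ≠ 0) {S : Matrix (Fin (m + 1)) (Fin (m + 1)) ℝ}
    (hS : ∀ i j, S i j = σ ^ 2 / (1 - a ^ 2) * a ^ Nat.dist (i : ℕ) (j : ℕ)) :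
    S.det = (σ ^ (m + 1)) ^ 2 / (1 - a ^ 2) := by
  have h1 : 0 < 1 - a ^ 2 := by linarith
  have h := det_sq_mul_det_of_whitening (arWhitening_mul_mul_transpose ha hσ hS)
  rw [det_arWhitening hσ, div_pow, Real.sq_sqrt h1.le] at h
  field_simp at h ⊢
  linarith

lemma trace_inv_mul_arCovariance {b : ℝ} (ha : a ^ 2 < 1) (hb : b ^ 2 < 1) (hσ : σ ≠ 0)
    {S₀ S₁ : Matrix (Fin (m + 1)) (Fin (m + 1)) ℝ}
    (hS₀ : ∀ i j, S₀ i j = σ ^ 2 / (1 - a ^ 2) * a ^ Nat.dist (i : ℕ) (j : ℕ))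
    (hS₁ : ∀ i j, S₁ i j = σ ^ 2 / (1 - b ^ 2) * b ^ Nat.dist (i : ℕ) (j : ℕ)) :
    (S₁⁻¹ * S₀).trace = (1 - b ^ 2 + m * (1 + b ^ 2 - 2 * a * b)) / (1 - a ^ 2) := by
  have h1 : 0 < 1 - a ^ 2 := by linarith
  have hsq : √(1 - b ^ 2) ^ 2 = 1 - b ^ 2 := Real.sq_sqrt (by linarith)
  rw [inv_eq_of_whitening (arWhitening_mul_mul_transpose hb hσ hS₁), mul_assoc, trace_mul_comm,
    trace, Fin.sum_univ_succ]
  simp only [diag_apply, mul_arWhitening_transpose_zero, arWhitening_mul_zero,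
    mul_arWhitening_transpose_succ, arWhitening_mul_succ, hS₀, Fin.val_zero, Fin.val_succ,
    Fin.val_castSucc, Nat.dist_self]
  have e2 : ∀ i : ℕ, Nat.dist i (i + 1) = 1 := fun i ↦ by simp only [Nat.dist]; omega
  have e3 : ∀ i : ℕ, Nat.dist (i + 1) i = 1 := fun i ↦ by simp only [Nat.dist]; omega
  simp only [e2, e3, Finset.sum_const, Finset.card_univ, Fintype.card_fin, nsmul_eq_mul]
  field_simp
  rw [hsq]
  ring

end Autoregressive

end Auxiliary

/-- Covertly changing the gain of a stable Gaussian AR(1) system from `a`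
to `b` (`0 < |a| < |b| < 1`, `sgn a = sgn b`): if the observation window satisfies
`n < 2b/(b-a)` and `|b| < √(1 - (1-a²) e^(-4ε²))`, then the total variation distance
between `N(0, Σ₀)` and `N(0, Σ₁)` (with `[Σ₀]_{ij} = σ_Z²/(1-a²) a^|i-j|`,
`[Σ₁]_{ij} = σ_Z²/(1-b²) b^|i-j|`) is at most `ε`; hence every test has `α + β ≥ 1 - ε`,
i.e. Alice achieves `ε`-covertness. -/
theorem covert_gain_change (a b σZ ε : ℝ) (ha0 : 0 < |a|) (hab : |a| < |b|) (hb1 : |b| < 1)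
    (hsgn : Real.sign a = Real.sign b) (hσ : 0 < σZ) (hε : 0 < ε)
    (n : ℕ) (hn : 1 ≤ n) (hwin : (n : ℝ) < 2 * b / (b - a))
    (hbcov : |b| < Real.sqrt (1 - (1 - a ^ 2) * Real.exp (-4 * ε ^ 2)))
    (S0 S1 : Matrix (Fin n) (Fin n) ℝ)
    (hS0 : ∀ i j : Fin n, S0 i j = σZ ^ 2 / (1 - a ^ 2) * a ^ Nat.dist (i : ℕ) (j : ℕ))
    (hS1 : ∀ i j : Fin n, S1 i j = σZ ^ 2 / (1 - b ^ 2) * b ^ Nat.dist (i : ℕ) (j : ℕ)) :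
    tvDist (mvGaussian 0 S0) (mvGaussian 0 S1) ≤ ε ∧
      ∀ A : Set (Fin n → ℝ), MeasurableSet A →
        1 - ε ≤ ((mvGaussian 0 S0) A).toReal + ((mvGaussian 0 S1) Aᶜ).toReal := by
  have ha1 : a ^ 2 < 1 := (sq_lt_one_iff_abs_lt_one a).2 (hab.trans hb1)
  have hb2 : b ^ 2 < 1 := (sq_lt_one_iff_abs_lt_one b).2 hb1
  obtain ⟨m, rfl⟩ := Nat.exists_eq_add_of_le' hn
  have hW0 := arWhitening_mul_mul_transpose ha1 hσ.ne' hS0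
  have hW1 := arWhitening_mul_mul_transpose hb2 hσ.ne' hS1
  have hP0 := isProbabilityMeasure_mvGaussian_s15 hW0
  have hP1 := isProbabilityMeasure_mvGaussian_s15 hW1
  have h0 : 0 < 1 - a ^ 2 := by linarith
  have h1 : 0 < 1 - b ^ 2 := by linarith
  have htrace : (S1⁻¹ * S0).trace ≤ (m + 1 : ℕ) := by
    have hprod : (b - a) * (((m + 1 : ℕ) : ℝ) * (b - a) - 2 * b) ≤ 0 := by
      rcases lt_trichotomy a 0 with ha | rfl | ha
      · have hb : b < 0 := by
          rcases lt_trichotomy b 0 with hb | rfl | hb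
          · exact hb
          · simp [Real.sign_of_neg ha] at hsgn
          · norm_num [Real.sign_of_neg ha, Real.sign_of_pos hb] at hsgn
        rw [abs_of_neg ha, abs_of_neg hb] at hab
        have h := (lt_div_iff_of_neg (by linarith : b - a < 0)).1 hwin
        exact mul_nonpos_of_nonpos_of_nonneg (by linarith) (by linarith)
      · simp at ha0
      · have hb : 0 < b := by
          rcases lt_trichotomy b 0 with hb | rfl | hb
          · norm_num [Real.sign_of_pos ha, Real.sign_of_neg hb] at hsgn
          · simp [Real.sign_of_pos ha] at hsgn
          · exact hb
        rw [abs_of_pos ha, abs_of_pos hb] at hab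
        have h := (lt_div_iff₀ (by linarith : 0 < b - a)).1 hwin
        exact mul_nonpos_of_nonneg_of_nonpos (by linarith) (by linarith)
    rw [trace_inv_mul_arCovariance ha1 hb2 hσ.ne' hS0 hS1, div_le_iff₀ h0]
    push_cast at hprod ⊢
    linarith
  have hlog : Real.log (S1.det / S0.det) < 4 * ε ^ 2 := by
    have hratio : S1.det / S0.det = (1 - a ^ 2) / (1 - b ^ 2) := by
      rw [det_arCovariance ha1 hσ.ne' hS0, det_arCovariance hb2 hσ.ne' hS1]
      field_simp
    have hb := (Real.lt_sqrt (abs_nonneg b)).1 hbcov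
    rw [sq_abs] at hb
    rw [hratio, Real.log_lt_iff_lt_exp (by positivity), div_lt_iff₀ h1]
    have hexp : Real.exp (4 * ε ^ 2) * Real.exp (-4 * ε ^ 2) = 1 := by
      rw [← Real.exp_add]; simp
    calc 1 - a ^ 2 = Real.exp (4 * ε ^ 2) * ((1 - a ^ 2) * Real.exp (-4 * ε ^ 2)) := by
          linear_combination (-(1 - a ^ 2)) * hexp
      _ < Real.exp (4 * ε ^ 2) * (1 - b ^ 2) := by gcongr; linarith
  have key : ∀ B : Set (Fin (m + 1) → ℝ), MeasurableSet B →
      |(mvGaussian 0 S0).real B - (mvGaussian 0 S1).real B| ≤ ε := by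
    intro B hB
    have h := two_mul_sq_measureReal_sub_le_integral_llr
      (mvGaussian_absolutelyContinuous (det_pos_of_whitening hW1))
      (integrable_llr_mvGaussian hW0 hW1) hB
    rw [integral_llr_mvGaussian_s15 hW0 hW1] at h
    exact abs_le_of_sq_le_sq (by linarith) hε.le
  refine ⟨Real.sSup_le ?_ hε.le, fun A hA ↦ ?_⟩
  · rintro x ⟨B, hB, rfl⟩
    exact key B hB
  · change 1 - ε ≤ (mvGaussian 0 S0).real A + (mvGaussian 0 S1).real Aᶜ
    rw [probReal_compl_eq_one_sub hA]
    linarith [neg_le_of_abs_le (key A hA)]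
end
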